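/- Assume the limiting system (ODE-Λ) has a solution (Λ₁, Λ₂) on [0, T], (S, r) solves (ODE-Sr), and define Θ, Θ₁ as well as Z₀ = −B₀(Θ + Θ₁), Z₁ = A + G − B(Θ + Θ₁). Let (Λ̌₁^N, Λ̌₂^N, Λ̌₁₂^N, Λ̌₂₂^N) be the unique solution on [0,T] of the linear system (ODE-Λ̌₁^N), (ODE-Λ̌₂^N), (ODE-Λ̌₁₂^N), (ODE-Λ̌₂₂^N), and for N large let (Λ₁^N, Λ₂^N) solve the rescaled system (ODE-Λ^N). Then there exist N₁ ≥ 1 and C > 0 such that for all N ≥ N₁, sup_{t∈[0,T]} |Λ₁^N(t) + Λ₂^N(t) − (Λ̌₁^N(t) + Λ̌₂^N(t) + Λ̌₁₂^N(t) + Λ̌₁₂^N(t)ᵀ + Λ̌₂₂^N(t))| ≤ C/N (|·| the Frobenius norm). -/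

import Mathlib

open Matrix Set

namespace LQ

/-- Frobenius norm of a real matrix. -/
noncomputable def frob {a b : Type*} [Fintype a] [Fintype b] (M : Matrix a b ℝ) : ℝ :=
  Real.sqrt (∑ i, ∑ j, (M i j) ^ 2)

/-- Entrywise ℓ₁ norm of a real matrix. -/
noncomputable def l1norm {a b : Type*} [Fintype a] [Fintype b] (M : Matrix a b ℝ) : ℝ :=
  ∑ i, ∑ j, |M i j|

/-- Block matrix with all diagonal m×m blocks equal to `F` and all off-diagonal blocks equal to `K`. -/
def blockConst (N m : ℕ) (F K : Matrix (Fin m) (Fin m) ℝ) :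
    Matrix (Fin N × Fin m) (Fin N × Fin m) ℝ :=
  Matrix.of fun x y => if x.1 = y.1 then F x.2 y.2 else K x.2 y.2

/-- Block matrix with diagonal blocks `Λ₁` and off-diagonal blocks `Λ₂ / N`. -/
noncomputable def blockPN (N n : ℕ) (Λ₁ Λ₂ : Matrix (Fin n) (Fin n) ℝ) :
    Matrix (Fin N × Fin n) (Fin N × Fin n) ℝ :=
  Matrix.of fun x y => if x.1 = y.1 then Λ₁ x.2 y.2 else Λ₂ x.2 y.2 / (N : ℝ)

/-- The permutation matrix exchanging the i-th and j-th block rows of `I_{Nn}`. -/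
def Jswap (N n : ℕ) (i j : Fin N) : Matrix (Fin N × Fin n) (Fin N × Fin n) ℝ :=
  Matrix.of fun x y => if y.1 = Equiv.swap i j x.1 ∧ y.2 = x.2 then 1 else 0

/-- `I_N ⊗ M`. -/
def kronIN (N : ℕ) {a b : ℕ} (M : Matrix (Fin a) (Fin b) ℝ) :
    Matrix (Fin N × Fin a) (Fin N × Fin b) ℝ :=
  Matrix.of fun x y => if x.1 = y.1 then M x.2 y.2 else 0

/-- `𝟏_{N×1} ⊗ M`. -/
def stackN (N : ℕ) {a b : ℕ} (M : Matrix (Fin a) (Fin b) ℝ) :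
    Matrix (Fin N × Fin a) (Fin b) ℝ :=
  Matrix.of fun x y => M x.2 y

/-- Data of the LQ mean field social optimization problem. -/
structure Params (n n₁ : ℕ) where
  A : Matrix (Fin n) (Fin n) ℝ
  G : Matrix (Fin n) (Fin n) ℝ
  Γ : Matrix (Fin n) (Fin n) ℝ
  Γf : Matrix (Fin n) (Fin n) ℝ
  B : Matrix (Fin n) (Fin n₁) ℝ
  B0 : Matrix (Fin n) (Fin n₁) ℝ
  B1 : Matrix (Fin n) (Fin n₁) ℝ
  D : Matrix (Fin n) (Fin 1) ℝ
  D0 : Matrix (Fin n) (Fin 1) ℝ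
  Q : Matrix (Fin n) (Fin n) ℝ
  Qf : Matrix (Fin n) (Fin n) ℝ
  R : Matrix (Fin n₁) (Fin n₁) ℝ
  T : ℝ

namespace Params

variable {n n₁ : ℕ} (p : Params n n₁)

/-- Standing hypotheses: positive dimensions, positive horizon, symmetric weights. -/
def Standing : Prop :=
  1 ≤ n ∧ 1 ≤ n₁ ∧ 0 < p.T ∧ p.Q.IsSymm ∧ p.Qf.IsSymm ∧ p.R.IsSymm

/-- Q^Γ = Γᵀ Q Γ − Q Γ − Γᵀ Q. -/
def QΓ : Matrix (Fin n) (Fin n) ℝ := p.Γᵀ * p.Q * p.Γ - p.Q * p.Γ - p.Γᵀ * p.Q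

/-- Q_f^Γ = Γ_fᵀ Q_f Γ_f − Q_f Γ_f − Γ_fᵀ Q_f. -/
def QfΓ : Matrix (Fin n) (Fin n) ℝ := p.Γfᵀ * p.Qf * p.Γf - p.Qf * p.Γf - p.Γfᵀ * p.Qf

/-- ℛ₁(Λ₁) = R + B₁ᵀ Λ₁ B₁. -/
def R1 (Λ₁ : Matrix (Fin n) (Fin n) ℝ) : Matrix (Fin n₁) (Fin n₁) ℝ :=
  p.R + p.B1ᵀ * Λ₁ * p.B1

/-- ℛ₂(Λ₁,Λ₂) = R + B₁ᵀ Λ₁ B₁ + B₀ᵀ(Λ₁+Λ₂)B₀. -/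
def R2 (Λ₁ Λ₂ : Matrix (Fin n) (Fin n) ℝ) : Matrix (Fin n₁) (Fin n₁) ℝ :=
  p.R + p.B1ᵀ * Λ₁ * p.B1 + p.B0ᵀ * (Λ₁ + Λ₂) * p.B0

/-- Ψ₁. -/
noncomputable def Ψ₁ (Λ₁ : Matrix (Fin n) (Fin n) ℝ) : Matrix (Fin n) (Fin n) ℝ :=
  Λ₁ * p.B * (p.R1 Λ₁)⁻¹ * p.Bᵀ * Λ₁ - Λ₁ * p.A - p.Aᵀ * Λ₁ - p.Q

/-- Ψ₂. -/
noncomputable def Ψ₂ (Λ₁ Λ₂ : Matrix (Fin n) (Fin n) ℝ) : Matrix (Fin n) (Fin n) ℝ :=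
  (Λ₁ + Λ₂) * p.B * (p.R2 Λ₁ Λ₂)⁻¹ * p.Bᵀ * (Λ₁ + Λ₂)
    - Λ₁ * p.B * (p.R1 Λ₁)⁻¹ * p.Bᵀ * Λ₁
    - (Λ₁ * p.G + Λ₂ * (p.A + p.G))
    - (p.Gᵀ * Λ₁ + (p.Aᵀ + p.Gᵀ) * Λ₂)
    - p.QΓ

/-- Solution of the limiting ODE system (ODE-Λ) on [0,T]. -/
noncomputable def IsSolLim (Λ₁ Λ₂ : ℝ → Matrix (Fin n) (Fin n) ℝ) : Prop :=
  (∀ t ∈ Icc (0 : ℝ) p.T, (Λ₁ t).IsSymm ∧ (Λ₂ t).IsSymm) ∧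
  (∀ t ∈ Icc (0 : ℝ) p.T, (p.R1 (Λ₁ t)).PosDef ∧ (p.R2 (Λ₁ t) (Λ₂ t)).PosDef) ∧
  Λ₁ p.T = p.Qf ∧ Λ₂ p.T = p.QfΓ ∧
  (∀ t ∈ Icc (0 : ℝ) p.T, ∀ i j, HasDerivWithinAt (fun s => Λ₁ s i j)
    (p.Ψ₁ (Λ₁ t) i j) (Icc (0 : ℝ) p.T) t) ∧
  (∀ t ∈ Icc (0 : ℝ) p.T, ∀ i j, HasDerivWithinAt (fun s => Λ₂ s i j)
    (p.Ψ₂ (Λ₁ t) (Λ₂ t) i j) (Icc (0 : ℝ) p.T) t)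

/-! Big (N-agent) matrices. -/

noncomputable def bigA (N : ℕ) : Matrix (Fin N × Fin n) (Fin N × Fin n) ℝ :=
  Matrix.of fun x y => (if x.1 = y.1 then p.A x.2 y.2 else 0) + p.G x.2 y.2 / (N : ℝ)

def bigBhat (N : ℕ) : Matrix (Fin N × Fin n) (Fin N × Fin n₁) ℝ :=
  Matrix.of fun x y => if x.1 = y.1 then p.B x.2 y.2 else 0

def bigB (N : ℕ) (i : Fin N) : Matrix (Fin N × Fin n) (Fin n₁) ℝ :=
  Matrix.of fun x l => if x.1 = i then p.B1 x.2 l else 0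

noncomputable def bigB0 (N : ℕ) : Matrix (Fin N × Fin n) (Fin n₁) ℝ :=
  Matrix.of fun x l => p.B0 x.2 l / (N : ℝ)

def bigD (N : ℕ) (i : Fin N) : Matrix (Fin N × Fin n) (Fin 1) ℝ :=
  Matrix.of fun x l => if x.1 = i then p.D x.2 l else 0

def bigD0 (N : ℕ) : Matrix (Fin N × Fin n) (Fin 1) ℝ :=
  Matrix.of fun x l => p.D0 x.2 l

def bigE (_p : Params n n₁) (N : ℕ) (i : Fin N) : Matrix (Fin n₁) (Fin N × Fin n₁) ℝ :=
  Matrix.of fun k y => if y.1 = i ∧ y.2 = k then 1 else 0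

def bigIhat (_p : Params n n₁) (N : ℕ) : Matrix (Fin n₁) (Fin N × Fin n₁) ℝ :=
  Matrix.of fun k y => if y.2 = k then 1 else 0

noncomputable def bigQ (N : ℕ) : Matrix (Fin N × Fin n) (Fin N × Fin n) ℝ :=
  Matrix.of fun x y => (if x.1 = y.1 then p.Q x.2 y.2 else 0) + p.QΓ x.2 y.2 / (N : ℝ)

noncomputable def bigQf (N : ℕ) : Matrix (Fin N × Fin n) (Fin N × Fin n) ℝ :=
  Matrix.of fun x y => (if x.1 = y.1 then p.Qf x.2 y.2 else 0) + p.QfΓ x.2 y.2 / (N : ℝ)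

def bigR (N : ℕ) : Matrix (Fin N × Fin n₁) (Fin N × Fin n₁) ℝ :=
  Matrix.of fun x y => if x.1 = y.1 then p.R x.2 y.2 else 0

/-- 𝓜₀. -/
noncomputable def M0 (N : ℕ) (Z : Matrix (Fin N × Fin n) (Fin N × Fin n) ℝ) :
    Matrix (Fin 1) (Fin 1) ℝ :=
  (1 / 2 : ℝ) • (∑ i : Fin N, (p.bigD N i)ᵀ * Z * p.bigD N i)
    + (1 / 2 : ℝ) • ((p.bigD0 N)ᵀ * Z * p.bigD0 N)

/-- 𝓜₁. -/
noncomputable def M1 (N : ℕ) (Z : Matrix (Fin N × Fin n) (Fin N × Fin n) ℝ) :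
    Matrix (Fin 1) (Fin N × Fin n₁) ℝ :=
  (∑ i : Fin N, (p.bigD N i)ᵀ * Z * p.bigB N i * p.bigE N i)
    + (p.bigD0 N)ᵀ * Z * p.bigB0 N * p.bigIhat N

/-- 𝓜₂. -/
noncomputable def M2 (N : ℕ) (Z : Matrix (Fin N × Fin n) (Fin N × Fin n) ℝ) :
    Matrix (Fin N × Fin n₁) (Fin N × Fin n₁) ℝ :=
  (1 / 2 : ℝ) • (∑ i : Fin N, (p.bigE N i)ᵀ * (p.bigB N i)ᵀ * Z * p.bigB N i * p.bigE N i)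
    + (1 / 2 : ℝ) • ((p.bigIhat N)ᵀ * (p.bigB0 N)ᵀ * Z * p.bigB0 N * p.bigIhat N)

/-- Right-hand side of the Riccati equation (ODE-P). -/
noncomputable def PRic (N : ℕ) (P : Matrix (Fin N × Fin n) (Fin N × Fin n) ℝ) :
    Matrix (Fin N × Fin n) (Fin N × Fin n) ℝ :=
  P * p.bigBhat N * (p.bigR N + (2 : ℝ) • p.M2 N P)⁻¹ * (p.bigBhat N)ᵀ * P
    - P * p.bigA N - (p.bigA N)ᵀ * P - p.bigQ N

/-- Solution of the large-scale Riccati equation (ODE-P) on [0,T]. -/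
noncomputable def IsSolP (N : ℕ) (P : ℝ → Matrix (Fin N × Fin n) (Fin N × Fin n) ℝ) : Prop :=
  (∀ t ∈ Icc (0 : ℝ) p.T, (P t).IsSymm) ∧
  (∀ t ∈ Icc (0 : ℝ) p.T, (p.bigR N + (2 : ℝ) • p.M2 N (P t)).PosDef) ∧
  P p.T = p.bigQf N ∧
  (∀ t ∈ Icc (0 : ℝ) p.T, ∀ x y, HasDerivWithinAt (fun s => P s x y)
    (p.PRic N (P t) x y) (Icc (0 : ℝ) p.T) t)

/-- Solution of the companion linear equation (ODE-S) on [0,T], relative to `P`. -/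
noncomputable def IsSolS (N : ℕ) (P : ℝ → Matrix (Fin N × Fin n) (Fin N × Fin n) ℝ)
    (S : ℝ → Matrix (Fin N × Fin n) (Fin 1) ℝ) : Prop :=
  S p.T = 0 ∧
  (∀ t ∈ Icc (0 : ℝ) p.T, ∀ x y, HasDerivWithinAt (fun s => S s x y)
    ((P t * p.bigBhat N * (p.bigR N + (2 : ℝ) • p.M2 N (P t))⁻¹ *
        ((p.bigBhat N)ᵀ * S t + (p.M1 N (P t))ᵀ) - (p.bigA N)ᵀ * S t) x y)
    (Icc (0 : ℝ) p.T) t)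

/-- Solution of the companion scalar equation (ODE-r) on [0,T], relative to `P` and `S`. -/
noncomputable def IsSolr (N : ℕ) (P : ℝ → Matrix (Fin N × Fin n) (Fin N × Fin n) ℝ)
    (S : ℝ → Matrix (Fin N × Fin n) (Fin 1) ℝ) (r : ℝ → ℝ) : Prop :=
  r p.T = 0 ∧
  (∀ t ∈ Icc (0 : ℝ) p.T, HasDerivWithinAt r
    (((((S t)ᵀ * p.bigBhat N + p.M1 N (P t)) * (p.bigR N + (2 : ℝ) • p.M2 N (P t))⁻¹ *
        ((p.bigBhat N)ᵀ * S t + (p.M1 N (P t))ᵀ)) - (2 : ℝ) • p.M0 N (P t)) 0 0)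
    (Icc (0 : ℝ) p.T) t)

/-- Asymptotic solvability of the LQ mean field social optimization problem. -/
noncomputable def AsympSolvable : Prop :=
  ∃ N₀ : ℕ, 1 ≤ N₀ ∧ ∃ c₀ : ℝ, 0 < c₀ ∧ ∃ C : ℝ,
    ∀ N : ℕ, N₀ ≤ N →
      ∃ P : ℝ → Matrix (Fin N × Fin n) (Fin N × Fin n) ℝ,
        p.IsSolP N P ∧
        (∀ t ∈ Icc (0 : ℝ) p.T, l1norm (P t) / (N : ℝ) ≤ C) ∧
        (∀ t ∈ Icc (0 : ℝ) p.T,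
          (p.bigR N + (2 : ℝ) • p.M2 N (P t) - c₀ • 1).PosSemidef)

/-! The rescaled low-dimensional system. -/

/-- E^N. -/
noncomputable def EN (N : ℕ) (Λ₁ Λ₂ : Matrix (Fin n) (Fin n) ℝ) :
    Matrix (Fin n₁) (Fin n₁) ℝ :=
  (1 / (N : ℝ)) •
    ((p.R2 Λ₁ Λ₂ - (1 / (N : ℝ)) • (p.B0ᵀ * Λ₂ * p.B0))⁻¹ - (p.R1 Λ₁)⁻¹)

/-- H^N. -/
noncomputable def HN (N : ℕ) (Λ₁ Λ₂ : Matrix (Fin n) (Fin n) ℝ) :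
    Matrix (Fin n₁) (Fin n₁) ℝ :=
  p.EN N Λ₁ Λ₂ + (p.R1 Λ₁)⁻¹

/-- g₁. -/
noncomputable def g₁ (N : ℕ) (Λ₁ Λ₂ : Matrix (Fin n) (Fin n) ℝ) :
    Matrix (Fin n) (Fin n) ℝ :=
  Λ₁ * p.B * p.EN N Λ₁ Λ₂ * p.Bᵀ * Λ₁
  + (1 - 1 / (N : ℝ)) •
      (Λ₂ * p.B * p.EN N Λ₁ Λ₂ * p.Bᵀ * Λ₁ + Λ₁ * p.B * p.EN N Λ₁ Λ₂ * p.Bᵀ * Λ₂)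
  + (1 / (N : ℝ) - 1 / (N : ℝ) ^ 2) •
      (Λ₂ * p.B * (p.HN N Λ₁ Λ₂ + ((N : ℝ) - 2) • p.EN N Λ₁ Λ₂) * p.Bᵀ * Λ₂)
  - (1 / (N : ℝ)) •
      ((Λ₁ * p.G + p.Gᵀ * Λ₁) + (1 - 1 / (N : ℝ)) • (Λ₂ * p.G + p.Gᵀ * Λ₂))
  - (1 / (N : ℝ)) • p.QΓ

/-- g₂. -/
noncomputable def g₂ (N : ℕ) (Λ₁ Λ₂ : Matrix (Fin n) (Fin n) ℝ) :
    Matrix (Fin n) (Fin n) ℝ :=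
  (Λ₁ + Λ₂) * p.B *
      ((N : ℝ) • p.EN N Λ₁ Λ₂ + (p.R1 Λ₁)⁻¹ - (p.R2 Λ₁ Λ₂)⁻¹) * p.Bᵀ * (Λ₁ + Λ₂)
  - (2 / (N : ℝ)) • (Λ₂ * p.B * (p.R1 Λ₁)⁻¹ * p.Bᵀ * Λ₂)
  + (1 / (N : ℝ) - 2) • (Λ₂ * p.B * p.EN N Λ₁ Λ₂ * p.Bᵀ * Λ₂)
  - Λ₁ * p.B * p.EN N Λ₁ Λ₂ * p.Bᵀ * Λ₂
  - Λ₂ * p.B * p.EN N Λ₁ Λ₂ * p.Bᵀ * Λ₁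
  + (1 / (N : ℝ)) • (Λ₂ * p.G + p.Gᵀ * Λ₂)

/-- Solution of the rescaled system (ODE-Λ^N) on [0,T]. -/
noncomputable def IsSolLamN (N : ℕ) (Λ₁ Λ₂ : ℝ → Matrix (Fin n) (Fin n) ℝ) : Prop :=
  (∀ t ∈ Icc (0 : ℝ) p.T, (Λ₁ t).IsSymm ∧ (Λ₂ t).IsSymm) ∧
  (∀ t ∈ Icc (0 : ℝ) p.T, (p.R1 (Λ₁ t)).PosDef ∧ (p.R2 (Λ₁ t) (Λ₂ t)).PosDef ∧
    (p.R2 (Λ₁ t) (Λ₂ t) - (1 / (N : ℝ)) • (p.B0ᵀ * Λ₂ t * p.B0)).PosDef) ∧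
  Λ₁ p.T = p.Qf + (1 / (N : ℝ)) • p.QfΓ ∧ Λ₂ p.T = p.QfΓ ∧
  (∀ t ∈ Icc (0 : ℝ) p.T, ∀ i j, HasDerivWithinAt (fun s => Λ₁ s i j)
    ((p.Ψ₁ (Λ₁ t) + p.g₁ N (Λ₁ t) (Λ₂ t)) i j) (Icc (0 : ℝ) p.T) t) ∧
  (∀ t ∈ Icc (0 : ℝ) p.T, ∀ i j, HasDerivWithinAt (fun s => Λ₂ s i j)
    ((p.Ψ₂ (Λ₁ t) (Λ₂ t) + p.g₂ N (Λ₁ t) (Λ₂ t)) i j) (Icc (0 : ℝ) p.T) t)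

/-! Companion (mean-field) equations. -/

/-- φ₁. -/
noncomputable def φ₁ (Λ₁ Λ₂ : Matrix (Fin n) (Fin n) ℝ) (S : Matrix (Fin n) (Fin 1) ℝ) :
    Matrix (Fin n) (Fin 1) ℝ :=
  (Λ₁ + Λ₂) * p.B * (p.R2 Λ₁ Λ₂)⁻¹ *
      (p.Bᵀ * S + p.B1ᵀ * Λ₁ * p.D + p.B0ᵀ * (Λ₁ + Λ₂) * p.D0)
    - (p.A + p.G)ᵀ * S

/-- φ₂. -/
noncomputable def φ₂ (Λ₁ Λ₂ : Matrix (Fin n) (Fin n) ℝ) (S : Matrix (Fin n) (Fin 1) ℝ) :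
    Matrix (Fin 1) (Fin 1) ℝ :=
  (Sᵀ * p.B + p.Dᵀ * Λ₁ * p.B1 + p.D0ᵀ * (Λ₁ + Λ₂) * p.B0) * (p.R2 Λ₁ Λ₂)⁻¹ *
      (p.Bᵀ * S + p.B1ᵀ * Λ₁ * p.D + p.B0ᵀ * (Λ₁ + Λ₂) * p.D0)
    - p.Dᵀ * Λ₁ * p.D - p.D0ᵀ * (Λ₁ + Λ₂) * p.D0

/-- Solution of the limiting companion system (ODE-Sr) on [0,T]. -/
noncomputable def IsSolSr (Λ₁ Λ₂ : ℝ → Matrix (Fin n) (Fin n) ℝ)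
    (S : ℝ → Matrix (Fin n) (Fin 1) ℝ) (r : ℝ → ℝ) : Prop :=
  S p.T = 0 ∧ r p.T = 0 ∧
  (∀ t ∈ Icc (0 : ℝ) p.T, ∀ i j, HasDerivWithinAt (fun s => S s i j)
    (p.φ₁ (Λ₁ t) (Λ₂ t) (S t) i j) (Icc (0 : ℝ) p.T) t) ∧
  (∀ t ∈ Icc (0 : ℝ) p.T, HasDerivWithinAt r
    ((p.φ₂ (Λ₁ t) (Λ₂ t) (S t)) 0 0) (Icc (0 : ℝ) p.T) t)

/-- g₀₁. -/
noncomputable def g01 (N : ℕ) (Λ₁ Λ₂ : Matrix (Fin n) (Fin n) ℝ)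
    (S : Matrix (Fin n) (Fin 1) ℝ) : Matrix (Fin n) (Fin 1) ℝ :=
  (Λ₁ + (1 - 1 / (N : ℝ)) • Λ₂) * p.B *
      (p.R2 Λ₁ Λ₂ - (1 / (N : ℝ)) • (p.B0ᵀ * Λ₂ * p.B0))⁻¹ *
      (p.Bᵀ * S + p.B1ᵀ * Λ₁ * p.D + p.B0ᵀ * (Λ₁ + (1 - 1 / (N : ℝ)) • Λ₂) * p.D0)
  - (Λ₁ + Λ₂) * p.B * (p.R2 Λ₁ Λ₂)⁻¹ *
      (p.Bᵀ * S + p.B1ᵀ * Λ₁ * p.D + p.B0ᵀ * (Λ₁ + Λ₂) * p.D0)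

/-- g₀₂. -/
noncomputable def g02 (N : ℕ) (Λ₁ Λ₂ : Matrix (Fin n) (Fin n) ℝ)
    (S : Matrix (Fin n) (Fin 1) ℝ) : Matrix (Fin 1) (Fin 1) ℝ :=
  (Sᵀ * p.B + p.Dᵀ * Λ₁ * p.B1 + p.D0ᵀ * (Λ₁ + (1 - 1 / (N : ℝ)) • Λ₂) * p.B0) *
      (p.R2 Λ₁ Λ₂ - (1 / (N : ℝ)) • (p.B0ᵀ * Λ₂ * p.B0))⁻¹ *
      (p.Bᵀ * S + p.B1ᵀ * Λ₁ * p.D + p.B0ᵀ * (Λ₁ + (1 - 1 / (N : ℝ)) • Λ₂) * p.D0)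
  - (Sᵀ * p.B + p.Dᵀ * Λ₁ * p.B1 + p.D0ᵀ * (Λ₁ + Λ₂) * p.B0) * (p.R2 Λ₁ Λ₂)⁻¹ *
      (p.Bᵀ * S + p.B1ᵀ * Λ₁ * p.D + p.B0ᵀ * (Λ₁ + Λ₂) * p.D0)
  + (1 / (N : ℝ)) • (p.D0ᵀ * Λ₂ * p.D0)

/-- Solution of the rescaled companion system (ODE-S^N r^N) on [0,T]. -/
noncomputable def IsSolSrN (N : ℕ) (Λ₁ Λ₂ : ℝ → Matrix (Fin n) (Fin n) ℝ)
    (S : ℝ → Matrix (Fin n) (Fin 1) ℝ) (r : ℝ → ℝ) : Prop :=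
  S p.T = 0 ∧ r p.T = 0 ∧
  (∀ t ∈ Icc (0 : ℝ) p.T, ∀ i j, HasDerivWithinAt (fun s => S s i j)
    ((p.φ₁ (Λ₁ t) (Λ₂ t) (S t) + p.g01 N (Λ₁ t) (Λ₂ t) (S t)) i j) (Icc (0 : ℝ) p.T) t) ∧
  (∀ t ∈ Icc (0 : ℝ) p.T, HasDerivWithinAt r
    ((p.φ₂ (Λ₁ t) (Λ₂ t) (S t) + p.g02 N (Λ₁ t) (Λ₂ t) (S t)) 0 0) (Icc (0 : ℝ) p.T) t)

/-! Feedback gains. -/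

/-- Θ = ℛ₁(Λ₁)⁻¹ Bᵀ Λ₁. -/
noncomputable def Theta (Λ₁ : Matrix (Fin n) (Fin n) ℝ) : Matrix (Fin n₁) (Fin n) ℝ :=
  (p.R1 Λ₁)⁻¹ * p.Bᵀ * Λ₁

/-- Θ₁ = (H₁ − H)Bᵀ(Λ₁+Λ₂) + HBᵀΛ₂. -/
noncomputable def Theta1 (Λ₁ Λ₂ : Matrix (Fin n) (Fin n) ℝ) : Matrix (Fin n₁) (Fin n) ℝ :=
  ((p.R2 Λ₁ Λ₂)⁻¹ - (p.R1 Λ₁)⁻¹) * p.Bᵀ * (Λ₁ + Λ₂) + (p.R1 Λ₁)⁻¹ * p.Bᵀ * Λ₂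

/-- Θ₂ = H₁[BᵀS + B₁ᵀΛ₁D + B₀ᵀ(Λ₁+Λ₂)D₀]. -/
noncomputable def Theta2 (Λ₁ Λ₂ : Matrix (Fin n) (Fin n) ℝ) (S : Matrix (Fin n) (Fin 1) ℝ) :
    Matrix (Fin n₁) (Fin 1) ℝ :=
  (p.R2 Λ₁ Λ₂)⁻¹ * (p.Bᵀ * S + p.B1ᵀ * Λ₁ * p.D + p.B0ᵀ * (Λ₁ + Λ₂) * p.D0)

/-- Θ^N. -/
noncomputable def ThetaN (N : ℕ) (Λ₁ Λ₂ : Matrix (Fin n) (Fin n) ℝ) :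
    Matrix (Fin n₁) (Fin n) ℝ :=
  (p.HN N Λ₁ Λ₂ - p.EN N Λ₁ Λ₂) * p.Bᵀ * (Λ₁ - (1 / (N : ℝ)) • Λ₂)

/-- Θ₁^N. -/
noncomputable def Theta1N (N : ℕ) (Λ₁ Λ₂ : Matrix (Fin n) (Fin n) ℝ) :
    Matrix (Fin n₁) (Fin n) ℝ :=
  (N : ℝ) • (p.EN N Λ₁ Λ₂ * p.Bᵀ * Λ₁)
    + (p.HN N Λ₁ Λ₂ + ((N : ℝ) - 2) • p.EN N Λ₁ Λ₂) * p.Bᵀ * Λ₂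

/-- Θ₂^N. -/
noncomputable def Theta2N (N : ℕ) (Λ₁ Λ₂ : Matrix (Fin n) (Fin n) ℝ)
    (S : Matrix (Fin n) (Fin 1) ℝ) : Matrix (Fin n₁) (Fin 1) ℝ :=
  (p.HN N Λ₁ Λ₂ + ((N : ℝ) - 1) • p.EN N Λ₁ Λ₂) *
    (p.Bᵀ * S + p.B1ᵀ * Λ₁ * p.D + p.B0ᵀ * (Λ₁ + (1 - 1 / (N : ℝ)) • Λ₂) * p.D0)

/-- Z₀ = −B₀(Θ + Θ₁). -/
noncomputable def Z0 (Λ₁ Λ₂ : Matrix (Fin n) (Fin n) ℝ) : Matrix (Fin n) (Fin n) ℝ :=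
  -(p.B0 * (p.Theta Λ₁ + p.Theta1 Λ₁ Λ₂))

/-- Z₁ = A + G − B(Θ + Θ₁). -/
noncomputable def Z1 (Λ₁ Λ₂ : Matrix (Fin n) (Fin n) ℝ) : Matrix (Fin n) (Fin n) ℝ :=
  p.A + p.G - p.B * (p.Theta Λ₁ + p.Theta1 Λ₁ Λ₂)

/-! The high-dimensional equations under the decentralized control. -/

/-- RHS of (ODE-P̌₁) (paper's −d𝐏̌₁/dt). -/
noncomputable def Pcheck1RHS (N : ℕ) (Θ : Matrix (Fin n₁) (Fin n) ℝ)
    (P1 : Matrix (Fin N × Fin n) (Fin N × Fin n) ℝ) :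
    Matrix (Fin N × Fin n) (Fin N × Fin n) ℝ :=
  (kronIN N Θ)ᵀ * (p.bigR N + p.M2 N ((2 : ℝ) • P1)) * kronIN N Θ
    + P1 * (p.bigA N - p.bigBhat N * kronIN N Θ)
    + (p.bigA N - p.bigBhat N * kronIN N Θ)ᵀ * P1
    + p.bigQ N

/-- Solution of (ODE-P̌₁) on [0,T], with Θ(t) built from Λ₁(t). -/
noncomputable def IsSolPcheck1 (N : ℕ) (Λ₁ : ℝ → Matrix (Fin n) (Fin n) ℝ)
    (P1 : ℝ → Matrix (Fin N × Fin n) (Fin N × Fin n) ℝ) : Prop :=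
  P1 p.T = p.bigQf N ∧
  (∀ t ∈ Icc (0 : ℝ) p.T, ∀ x y, HasDerivWithinAt (fun s => P1 s x y)
    ((-(p.Pcheck1RHS N (p.Theta (Λ₁ t)) (P1 t))) x y) (Icc (0 : ℝ) p.T) t)

/-- RHS of (ODE-P̌₁₂) (paper's −d𝐏̌₁₂/dt). -/
noncomputable def Pcheck12RHS (N : ℕ) (Λ₁m Λ₂m : Matrix (Fin n) (Fin n) ℝ)
    (P1 : Matrix (Fin N × Fin n) (Fin N × Fin n) ℝ)
    (P12 : Matrix (Fin N × Fin n) (Fin n) ℝ) :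
    Matrix (Fin N × Fin n) (Fin n) ℝ :=
  (kronIN N (p.Theta Λ₁m))ᵀ * (p.bigR N + p.M2 N ((2 : ℝ) • P1)) *
      stackN N (p.Theta1 Λ₁m Λ₂m)
    - P1 * p.bigBhat N * stackN N (p.Theta1 Λ₁m Λ₂m)
    + ((p.bigA N)ᵀ - (kronIN N (p.Theta Λ₁m))ᵀ * (p.bigBhat N)ᵀ) * P12
    + P12 * p.Z1 Λ₁m Λ₂m
    - (kronIN N (p.Theta Λ₁m))ᵀ * (p.bigIhat N)ᵀ * (p.bigB0 N)ᵀ * P12 * p.Z0 Λ₁m Λ₂m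

/-- Solution of (ODE-P̌₁₂) on [0,T]. -/
noncomputable def IsSolPcheck12 (N : ℕ) (Λ₁ Λ₂ : ℝ → Matrix (Fin n) (Fin n) ℝ)
    (P1 : ℝ → Matrix (Fin N × Fin n) (Fin N × Fin n) ℝ)
    (P12 : ℝ → Matrix (Fin N × Fin n) (Fin n) ℝ) : Prop :=
  P12 p.T = 0 ∧
  (∀ t ∈ Icc (0 : ℝ) p.T, ∀ x y, HasDerivWithinAt (fun s => P12 s x y)
    ((-(p.Pcheck12RHS N (Λ₁ t) (Λ₂ t) (P1 t) (P12 t))) x y) (Icc (0 : ℝ) p.T) t)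

/-! The decentralized-control low-dimensional coefficient system. -/

/-- ǧ₁. -/
noncomputable def gc1 (N : ℕ) (Θ : Matrix (Fin n₁) (Fin n) ℝ)
    (L1 L2 : Matrix (Fin n) (Fin n) ℝ) : Matrix (Fin n) (Fin n) ℝ :=
  (1 / (N : ℝ)) •
    (Θᵀ * p.B0ᵀ * (L1 + (1 - 1 / (N : ℝ)) • L2) * p.B0 * Θ
      + (L1 + (1 - 1 / (N : ℝ)) • L2) * p.G
      + p.Gᵀ * (L1 + (1 - 1 / (N : ℝ)) • L2)
      + p.QΓ)

/-- ǧ₂. -/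
noncomputable def gc2 (N : ℕ) (Θ : Matrix (Fin n₁) (Fin n) ℝ)
    (L2 : Matrix (Fin n) (Fin n) ℝ) : Matrix (Fin n) (Fin n) ℝ :=
  -((1 / (N : ℝ)) • (Θᵀ * p.B0ᵀ * L2 * p.B0 * Θ + L2 * p.G + p.Gᵀ * L2))

/-- ǧ₁₂. -/
noncomputable def gc12 (N : ℕ) (Θ Θ₁ : Matrix (Fin n₁) (Fin n) ℝ)
    (L2 : Matrix (Fin n) (Fin n) ℝ) : Matrix (Fin n) (Fin n) ℝ :=
  (1 / (N : ℝ)) • (-(Θᵀ * p.B0ᵀ * L2 * p.B0 * Θ₁) + L2 * p.B * Θ₁)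

/-- ǧ₂₂. -/
noncomputable def gc22 (N : ℕ) (Θ₁ : Matrix (Fin n₁) (Fin n) ℝ)
    (L2 : Matrix (Fin n) (Fin n) ℝ) : Matrix (Fin n) (Fin n) ℝ :=
  -((1 / (N : ℝ)) • (Θ₁ᵀ * p.B0ᵀ * L2 * p.B0 * Θ₁))

/-- ǧ₀₁. -/
noncomputable def gc01 (N : ℕ) (Θ : Matrix (Fin n₁) (Fin n) ℝ)
    (Θ₂ : Matrix (Fin n₁) (Fin 1) ℝ) (L2 : Matrix (Fin n) (Fin n) ℝ) :
    Matrix (Fin n) (Fin 1) ℝ :=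
  (1 / (N : ℝ)) • (Θᵀ * p.B0ᵀ * L2 * (p.D0 - p.B0 * Θ₂) + L2 * p.B * Θ₂)

/-- ǧ₀₂. -/
noncomputable def gc02 (N : ℕ) (Θ₁ : Matrix (Fin n₁) (Fin n) ℝ)
    (Θ₂ : Matrix (Fin n₁) (Fin 1) ℝ) (L2 : Matrix (Fin n) (Fin n) ℝ) :
    Matrix (Fin n) (Fin 1) ℝ :=
  (1 / (N : ℝ)) • (-(Θ₁ᵀ * p.B0ᵀ * L2 * p.B0 * Θ₂) + Θ₁ᵀ * p.B0ᵀ * L2 * p.D0)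

/-- RHS of (ODE-Λ̌₁^N) (paper's −dΛ̌₁^N/dt). -/
noncomputable def check1RHS (N : ℕ) (Θ : Matrix (Fin n₁) (Fin n) ℝ)
    (L1 L2 : Matrix (Fin n) (Fin n) ℝ) : Matrix (Fin n) (Fin n) ℝ :=
  Θᵀ * p.R1 L1 * Θ + L1 * (p.A - p.B * Θ) + (p.A - p.B * Θ)ᵀ * L1 + p.Q
    + p.gc1 N Θ L1 L2

/-- RHS of (ODE-Λ̌₂^N). -/
noncomputable def check2RHS (N : ℕ) (Θ : Matrix (Fin n₁) (Fin n) ℝ)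
    (L1 L2 : Matrix (Fin n) (Fin n) ℝ) : Matrix (Fin n) (Fin n) ℝ :=
  Θᵀ * p.B0ᵀ * (L1 + L2) * p.B0 * Θ + L1 * p.G + p.Gᵀ * L1
    + L2 * (p.A + p.G - p.B * Θ) + (p.A + p.G - p.B * Θ)ᵀ * L2 + p.QΓ
    + p.gc2 N Θ L2

/-- RHS of (ODE-Λ̌₁₂^N). -/
noncomputable def check12RHS (N : ℕ) (Θ Θ₁ : Matrix (Fin n₁) (Fin n) ℝ)
    (L1 L2 L12 : Matrix (Fin n) (Fin n) ℝ) : Matrix (Fin n) (Fin n) ℝ :=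
  Θᵀ * p.R2 L1 L2 * Θ₁ + Θᵀ * p.B0ᵀ * L12 * p.B0 * (Θ + Θ₁)
    - (L1 + L2) * p.B * Θ₁
    + (p.A + p.G - p.B * Θ)ᵀ * L12
    + L12 * (p.A + p.G - p.B * (Θ₁ + Θ))
    + p.gc12 N Θ Θ₁ L2

/-- RHS of (ODE-Λ̌₂₂^N). -/
noncomputable def check22RHS (N : ℕ) (Θ₁ : Matrix (Fin n₁) (Fin n) ℝ)
    (Z₀ Z₁ : Matrix (Fin n) (Fin n) ℝ)
    (L1 L2 L12 L22 : Matrix (Fin n) (Fin n) ℝ) : Matrix (Fin n) (Fin n) ℝ :=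
  Θ₁ᵀ * p.R2 L1 L2 * Θ₁ - L12ᵀ * p.B * Θ₁ - Θ₁ᵀ * p.Bᵀ * L12
    + L22 * Z₁ + Z₁ᵀ * L22
    - Z₀ᵀ * L12ᵀ * p.B0 * Θ₁ - Θ₁ᵀ * p.B0ᵀ * L12 * Z₀
    + Z₀ᵀ * L22 * Z₀ + p.gc22 N Θ₁ L2

/-- RHS of (ODE-Š₁^N). -/
noncomputable def checkS1RHS (N : ℕ) (Θ : Matrix (Fin n₁) (Fin n) ℝ)
    (Θ₂ : Matrix (Fin n₁) (Fin 1) ℝ) (L1 L2 L12 : Matrix (Fin n) (Fin n) ℝ)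
    (S1 : Matrix (Fin n) (Fin 1) ℝ) : Matrix (Fin n) (Fin 1) ℝ :=
  Θᵀ * p.R2 L1 L2 * Θ₂ - (L1 + L2 + L12) * p.B * Θ₂
    - Θᵀ * (p.Bᵀ * S1 + p.B1ᵀ * L1 * p.D + p.B0ᵀ * (L1 + L2) * p.D0)
    - Θᵀ * p.B0ᵀ * L12 * (p.D0 - p.B0 * Θ₂)
    + (p.A + p.G)ᵀ * S1
    + p.gc01 N Θ Θ₂ L2

/-- RHS of (ODE-Š₂^N). -/
noncomputable def checkS2RHS (N : ℕ) (Θ₁ : Matrix (Fin n₁) (Fin n) ℝ)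
    (Θ₂ : Matrix (Fin n₁) (Fin 1) ℝ) (Z₀ Z₁ : Matrix (Fin n) (Fin n) ℝ)
    (L1 L2 L12 L22 : Matrix (Fin n) (Fin n) ℝ)
    (S1 S2 : Matrix (Fin n) (Fin 1) ℝ) : Matrix (Fin n) (Fin 1) ℝ :=
  Θ₁ᵀ * p.R2 L1 L2 * Θ₂ + Z₁ᵀ * S2
    - Θ₁ᵀ * (p.Bᵀ * S1 + p.B1ᵀ * L1 * p.D + p.B0ᵀ * (L1 + L2) * p.D0)
    + (Z₀ᵀ * L22 + Z₀ᵀ * L12ᵀ - Θ₁ᵀ * p.B0ᵀ * L12) * (p.D0 - p.B0 * Θ₂)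
    - (L12ᵀ + L22) * p.B * Θ₂
    + p.gc02 N Θ₁ Θ₂ L2

/-- Solution of the pair (ODE-Λ̌₁^N)–(ODE-Λ̌₂^N) on [0,T], with Θ(t) from the limiting Λ₁. -/
noncomputable def IsSolCheckA (N : ℕ) (Λ₁ : ℝ → Matrix (Fin n) (Fin n) ℝ)
    (L1 L2 : ℝ → Matrix (Fin n) (Fin n) ℝ) : Prop :=
  L1 p.T = p.Qf + (1 / (N : ℝ)) • p.QfΓ ∧ L2 p.T = p.QfΓ ∧
  (∀ t ∈ Icc (0 : ℝ) p.T, ∀ i j, HasDerivWithinAt (fun s => L1 s i j)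
    ((-(p.check1RHS N (p.Theta (Λ₁ t)) (L1 t) (L2 t))) i j) (Icc (0 : ℝ) p.T) t) ∧
  (∀ t ∈ Icc (0 : ℝ) p.T, ∀ i j, HasDerivWithinAt (fun s => L2 s i j)
    ((-(p.check2RHS N (p.Theta (Λ₁ t)) (L1 t) (L2 t))) i j) (Icc (0 : ℝ) p.T) t)

/-- Solution of (ODE-Λ̌₁^N)–(ODE-Λ̌₂₂^N) on [0,T], with Θ, Θ₁, Z₀, Z₁ from the limiting (Λ₁, Λ₂). -/
noncomputable def IsSolCheckB (N : ℕ) (Λ₁ Λ₂ : ℝ → Matrix (Fin n) (Fin n) ℝ)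
    (L1 L2 L12 L22 : ℝ → Matrix (Fin n) (Fin n) ℝ) : Prop :=
  p.IsSolCheckA N Λ₁ L1 L2 ∧
  L12 p.T = 0 ∧ L22 p.T = 0 ∧
  (∀ t ∈ Icc (0 : ℝ) p.T, ∀ i j, HasDerivWithinAt (fun s => L12 s i j)
    ((-(p.check12RHS N (p.Theta (Λ₁ t)) (p.Theta1 (Λ₁ t) (Λ₂ t))
        (L1 t) (L2 t) (L12 t))) i j) (Icc (0 : ℝ) p.T) t) ∧
  (∀ t ∈ Icc (0 : ℝ) p.T, ∀ i j, HasDerivWithinAt (fun s => L22 s i j)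
    ((-(p.check22RHS N (p.Theta1 (Λ₁ t) (Λ₂ t)) (p.Z0 (Λ₁ t) (Λ₂ t))
        (p.Z1 (Λ₁ t) (Λ₂ t)) (L1 t) (L2 t) (L12 t) (L22 t))) i j) (Icc (0 : ℝ) p.T) t)

/-- Solution of the full decentralized coefficient system on [0,T],
with Θ, Θ₁, Θ₂, Z₀, Z₁ from the limiting (Λ₁, Λ₂, S). -/
noncomputable def IsSolCheckC (N : ℕ) (Λ₁ Λ₂ : ℝ → Matrix (Fin n) (Fin n) ℝ)
    (S : ℝ → Matrix (Fin n) (Fin 1) ℝ)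
    (L1 L2 L12 L22 : ℝ → Matrix (Fin n) (Fin n) ℝ)
    (S1 S2 : ℝ → Matrix (Fin n) (Fin 1) ℝ) : Prop :=
  p.IsSolCheckB N Λ₁ Λ₂ L1 L2 L12 L22 ∧
  S1 p.T = 0 ∧ S2 p.T = 0 ∧
  (∀ t ∈ Icc (0 : ℝ) p.T, ∀ i j, HasDerivWithinAt (fun s => S1 s i j)
    ((-(p.checkS1RHS N (p.Theta (Λ₁ t)) (p.Theta2 (Λ₁ t) (Λ₂ t) (S t))
        (L1 t) (L2 t) (L12 t) (S1 t))) i j) (Icc (0 : ℝ) p.T) t) ∧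
  (∀ t ∈ Icc (0 : ℝ) p.T, ∀ i j, HasDerivWithinAt (fun s => S2 s i j)
    ((-(p.checkS2RHS N (p.Theta1 (Λ₁ t) (Λ₂ t)) (p.Theta2 (Λ₁ t) (Λ₂ t) (S t))
        (p.Z0 (Λ₁ t) (Λ₂ t)) (p.Z1 (Λ₁ t) (Λ₂ t))
        (L1 t) (L2 t) (L12 t) (L22 t) (S1 t) (S2 t))) i j) (Icc (0 : ℝ) p.T) t)

end Params

end LQ

theorem IsCompact.exists_lipschitz_bound_of_contDiffAt {E F : Type*}
    [NormedAddCommGroup E] [NormedSpace ℝ E] [NormedAddCommGroup F] [NormedSpace ℝ F]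
    {f : E → F} {K : Set E} (hK : IsCompact K) (hf : ∀ z ∈ K, ContDiffAt ℝ 1 f z) :
    ∃ δ : ℝ, 0 < δ ∧ ∃ L : ℝ, 0 ≤ L ∧
      ∀ z ∈ K, ∀ w, ‖w - z‖ ≤ δ → ‖f w - f z‖ ≤ L * ‖w - z‖ := by
  refine hK.induction_on (p := fun s => ∃ δ : ℝ, 0 < δ ∧ ∃ L : ℝ, 0 ≤ L ∧
      ∀ z ∈ s, ∀ w, ‖w - z‖ ≤ δ → ‖f w - f z‖ ≤ L * ‖w - z‖) ?_ ?_ ?_ ?_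
  · exact ⟨1, one_pos, 0, le_rfl, fun z hz => hz.elim⟩
  · rintro s t hst ⟨δ, hδ, L, hL, h⟩
    exact ⟨δ, hδ, L, hL, fun z hz => h z (hst hz)⟩
  · rintro s t ⟨δ, hδ, L, hL, h⟩ ⟨δ', hδ', L', hL', h'⟩
    refine ⟨min δ δ', lt_min hδ hδ', max L L', hL.trans (le_max_left _ _), ?_⟩
    rintro z (hz | hz) w hw
    · exact (h z hz w (hw.trans (min_le_left _ _))).trans (by gcongr; exact le_max_left _ _)
    · exact (h' z hz w (hw.trans (min_le_right _ _))).trans (by gcongr; exact le_max_right _ _)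
  · intro z hz
    obtain ⟨L, V, hV, hL⟩ := (hf z hz).exists_lipschitzOnWith
    obtain ⟨ε, hε, hεV⟩ := Metric.mem_nhds_iff.1 hV
    refine ⟨Metric.ball z (ε / 2), mem_nhdsWithin_of_mem_nhds (Metric.ball_mem_nhds z (half_pos hε)),
      ε / 4, by positivity, L, L.2, ?_⟩
    intro v hv w hw
    rw [Metric.mem_ball] at hv
    have hwv : dist w v ≤ ε / 4 := by rwa [dist_eq_norm]
    have hvV : v ∈ V := hεV (by rw [Metric.mem_ball]; linarith)
    have hw' : w ∈ V := hεV (by rw [Metric.mem_ball]; linarith [dist_triangle w v z])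
    simpa [dist_eq_norm] using hL.dist_le_mul w hw' v hvV

/-- A backward Grönwall estimate whose differential inequality is only required on the region where
the claimed bound holds. -/
theorem norm_le_mul_exp_of_norm_deriv_le {E : Type*} [NormedAddCommGroup E] [NormedSpace ℝ E]
    {u u' : ℝ → E} {T L ε : ℝ} (hε : 0 < ε) (hL : 0 ≤ L)
    (hu : ∀ t ∈ Icc 0 T, HasDerivWithinAt u (u' t) (Icc 0 T) t) (huT : ‖u T‖ ≤ ε)
    (hbound : ∀ t ∈ Icc 0 T, ‖u t‖ ≤ ε * Real.exp ((2 * L + 2) * T) →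
      ‖u' t‖ ≤ L * (ε + ‖u t‖)) :
    ∀ t ∈ Icc 0 T, ‖u t‖ ≤ ε * Real.exp ((2 * L + 2) * T) := by
  have hmaps : MapsTo (fun s : ℝ => T - s) (Icc 0 T) (Icc 0 T) := fun s hs =>
    ⟨by linarith [hs.2], by linarith [hs.1]⟩
  have hrev : ∀ s ∈ Icc 0 T,
      HasDerivWithinAt (fun s => u (T - s)) (-u' (T - s)) (Icc 0 T) s := fun s hs => by
    simpa [Function.comp_def] using (hu (T - s) (hmaps hs)).scomp s
      (((hasDerivAt_id s).const_sub T).hasDerivWithinAt) hmaps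
  have hmono : ∀ s ≤ T,
      ε * Real.exp ((2 * L + 2) * s) ≤ ε * Real.exp ((2 * L + 2) * T) := fun s hs => by
    gcongr
  have key := image_norm_le_of_norm_deriv_right_lt_deriv_boundary
    (f := fun s => u (T - s)) (f' := fun s => -u' (T - s)) (a := 0) (b := T)
    (B := fun s => ε * Real.exp ((2 * L + 2) * s))
    (B' := fun s => ε * (Real.exp ((2 * L + 2) * s) * (2 * L + 2)))
    (fun s hs => (hrev s hs).continuousWithinAt)
    (fun s hs => (hrev s (Ico_subset_Icc_self hs)).mono_of_mem_nhdsWithin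
      (Icc_mem_nhdsGE_of_mem hs))
    (by simpa using huT)
    (fun s => by
      simpa using ((((hasDerivAt_id s).const_mul (2 * L + 2)).exp).const_mul ε))
    (fun s hs heq => by
      have hs' := Ico_subset_Icc_self hs
      have h1 := hbound (T - s) (hmaps hs') (heq.le.trans (hmono s hs'.2))
      have h2 : ε ≤ ε * Real.exp ((2 * L + 2) * s) :=
        le_mul_of_one_le_right hε.le (Real.one_le_exp (by have := hs.1; positivity))
      have h3 : ‖u (T - s)‖ = ε * Real.exp ((2 * L + 2) * s) := heq
      rw [h3] at h1
      rw [norm_neg]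
      nlinarith [mul_le_mul_of_nonneg_left h2 hL])
  intro t ht
  have h := key (hmaps ht)
  simp only [sub_sub_cancel] at h
  exact h.trans (hmono _ (hmaps ht).2)

/-- Solutions of a terminal value problem depend on a scalar parameter in a Lipschitz way. -/
theorem exists_norm_sub_le_mul_of_contDiffAt {E : Type*} [NormedAddCommGroup E] [NormedSpace ℝ E]
    {F : ℝ × E → E} {T : ℝ} {x : ℝ → E} (v : E)
    (hx : ∀ t ∈ Icc 0 T, HasDerivWithinAt x (F (0, x t)) (Icc 0 T) t)
    (hF : ∀ t ∈ Icc 0 T, ContDiffAt ℝ 1 F (0, x t)) :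
    ∃ h₀ : ℝ, 0 < h₀ ∧ ∃ C : ℝ, 0 < C ∧ ∀ h : ℝ, 0 < h → h ≤ h₀ → ∀ y : ℝ → E,
      y T = x T + h • v →
      (∀ t ∈ Icc 0 T, HasDerivWithinAt y (F (h, y t)) (Icc 0 T) t) →
      ∀ t ∈ Icc 0 T, ‖y t - x t‖ ≤ C * h := by
  have hK : IsCompact ((fun t => ((0 : ℝ), x t)) '' Icc 0 T) :=
    isCompact_Icc.image_of_continuousOn
      (continuousOn_const.prodMk fun t ht => (hx t ht).continuousWithinAt)
  obtain ⟨δ, hδ, L, hL, hlip⟩ :=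
    hK.exists_lipschitz_bound_of_contDiffAt (f := F) (by rintro _ ⟨t, ht, rfl⟩; exact hF t ht)
  set M := (‖v‖ + 1) * Real.exp ((2 * L + 2) * T) with hM
  have hMpos : 0 < M := by positivity
  refine ⟨min δ (δ / M), by positivity, M, hMpos, fun h hh hle y hyT hy => ?_⟩
  have hhδ : h ≤ δ := hle.trans (min_le_left _ _)
  have hhM : M * h ≤ δ := by
    have := (le_div_iff₀ hMpos).1 (hle.trans (min_le_right _ _))
    linarith
  have hMh : h * (‖v‖ + 1) * Real.exp ((2 * L + 2) * T) = M * h := by rw [hM]; ring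
  rw [← hMh]
  refine norm_le_mul_exp_of_norm_deriv_le (u := fun t => y t - x t) (by positivity) hL
    (fun t ht => (hy t ht).sub (hx t ht)) ?_ ?_
  · simp only [hyT, add_sub_cancel_left, norm_smul, Real.norm_eq_abs, abs_of_pos hh]
    nlinarith
  · intro t ht hle'
    have hsub : ((h, y t) : ℝ × E) - (0, x t) = (h, y t - x t) := by simp
    have hnorm : ‖((h, y t) : ℝ × E) - (0, x t)‖ = max h ‖y t - x t‖ := by
      rw [hsub, Prod.norm_mk, Real.norm_eq_abs, abs_of_pos hh]
    have h1 := hlip (0, x t) ⟨t, ht, rfl⟩ (h, y t)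
      (by rw [hnorm]; exact max_le hhδ (hle'.trans (hMh.le.trans hhM)))
    refine h1.trans (mul_le_mul_of_nonneg_left ?_ hL)
    rw [hnorm]
    refine max_le ?_ ?_
    · nlinarith [norm_nonneg v, norm_nonneg (y t - x t)]
    · have : 0 ≤ h * (‖v‖ + 1) := by positivity
      linarith

attribute [local instance] Matrix.normedAddCommGroup Matrix.normedSpace

section MatrixCalculus

theorem hasDerivWithinAt_matrix {l m : Type*} [Fintype m] {f : ℝ → Matrix l m ℝ} {f' : Matrix l m ℝ}
    {s : Set ℝ} {t : ℝ} :
    HasDerivWithinAt f f' s t ↔ ∀ i j, HasDerivWithinAt (fun y => f y i j) (f' i j) s t := by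
  refine (hasDerivWithinAt_pi (φ := f)).trans (forall_congr' fun i => ?_)
  exact hasDerivWithinAt_pi (φ := fun y => f y i)

variable {E : Type*} [NormedAddCommGroup E] [NormedSpace ℝ E] {x : E}
variable {l m n : Type*} [Fintype l] [Fintype m] [Fintype n]

theorem contDiffAt_matrix {k : WithTop ℕ∞} {f : E → Matrix l m ℝ} :
    ContDiffAt ℝ k f x ↔ ∀ i j, ContDiffAt ℝ k (fun y => f y i j) x := by
  refine (contDiffAt_pi (Φ := f)).trans (forall_congr' fun i => ?_)
  exact contDiffAt_pi (Φ := fun y => f y i)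

@[fun_prop]
theorem ContDiffAt.matrix_mul {k : WithTop ℕ∞} {f : E → Matrix l m ℝ} {g : E → Matrix m n ℝ}
    (hf : ContDiffAt ℝ k f x) (hg : ContDiffAt ℝ k g x) :
    ContDiffAt ℝ k (fun y => f y * g y) x := by
  rw [contDiffAt_matrix] at *
  intro i j
  simp only [Matrix.mul_apply]
  exact ContDiffAt.sum fun a _ => (hf i a).mul (hg a j)

@[fun_prop]
theorem ContDiffAt.matrix_transpose {k : WithTop ℕ∞} {f : E → Matrix l m ℝ}
    (hf : ContDiffAt ℝ k f x) : ContDiffAt ℝ k (fun y => (f y)ᵀ) x := by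
  rw [contDiffAt_matrix] at *
  exact fun i j => hf j i

theorem ContDiffAt.matrix_det [DecidableEq m] {k : WithTop ℕ∞} {f : E → Matrix m m ℝ}
    (hf : ContDiffAt ℝ k f x) : ContDiffAt ℝ k (fun y => (f y).det) x := by
  rw [contDiffAt_matrix] at hf
  simp only [Matrix.det_apply]
  exact ContDiffAt.sum fun σ _ => (contDiffAt_prod fun i _ => hf (σ i) i).const_smul _

@[fun_prop]
theorem ContDiffAt.matrix_inv [DecidableEq m] {k : WithTop ℕ∞} {f : E → Matrix m m ℝ}
    (hf : ContDiffAt ℝ k f x) (hx : (f x).det ≠ 0) : ContDiffAt ℝ k (fun y => (f y)⁻¹) x := by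
  have hf' := hf
  rw [contDiffAt_matrix] at hf' ⊢
  intro i j
  simp only [Matrix.inv_def, Ring.inverse_eq_inv', Matrix.smul_apply, smul_eq_mul,
    Matrix.adjugate_apply]
  refine (hf.matrix_det.inv hx).mul (ContDiffAt.matrix_det (contDiffAt_matrix.2 fun a b => ?_))
  by_cases h : a = j
  · subst h; simpa using contDiffAt_const
  · simpa [Matrix.updateRow_ne h] using hf' a b

theorem HasDerivWithinAt.matrix_transpose {f : ℝ → Matrix l m ℝ} {f' : Matrix l m ℝ} {s : Set ℝ}
    {t : ℝ} (hf : HasDerivWithinAt f f' s t) :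
    HasDerivWithinAt (fun y => (f y)ᵀ) f'ᵀ s t := by
  rw [hasDerivWithinAt_matrix] at *
  exact fun i j => hf j i

end MatrixCalculus

namespace LQ

namespace Params

variable {n n₁ : ℕ} (p : Params n n₁)

/-! Parametrized vector fields: `h` stands for `1 / N`. -/

/-- `(ℛ₂(Λ₁,Λ₂) - h B₀ᵀ Λ₂ B₀)⁻¹ - ℛ₁(Λ₁)⁻¹`, which is `N • E^N` when `h = 1 / N`. -/
noncomputable def invGap (h : ℝ) (Λ₁ Λ₂ : Matrix (Fin n) (Fin n) ℝ) :
    Matrix (Fin n₁) (Fin n₁) ℝ :=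
  (p.R2 Λ₁ Λ₂ - h • (p.B0ᵀ * Λ₂ * p.B0))⁻¹ - (p.R1 Λ₁)⁻¹

/-- `g₁` with `1 / N` replaced by a real parameter. -/
noncomputable def g₁Param (h : ℝ) (Λ₁ Λ₂ : Matrix (Fin n) (Fin n) ℝ) :
    Matrix (Fin n) (Fin n) ℝ :=
  Λ₁ * p.B * (h • p.invGap h Λ₁ Λ₂) * p.Bᵀ * Λ₁
  + (1 - h) •
      (Λ₂ * p.B * (h • p.invGap h Λ₁ Λ₂) * p.Bᵀ * Λ₁
        + Λ₁ * p.B * (h • p.invGap h Λ₁ Λ₂) * p.Bᵀ * Λ₂)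
  + (h - h ^ 2) •
      (Λ₂ * p.B * ((p.R1 Λ₁)⁻¹ + (1 - h) • p.invGap h Λ₁ Λ₂) * p.Bᵀ * Λ₂)
  - h • ((Λ₁ * p.G + p.Gᵀ * Λ₁) + (1 - h) • (Λ₂ * p.G + p.Gᵀ * Λ₂))
  - h • p.QΓ

/-- `g₂` with `1 / N` replaced by a real parameter. -/
noncomputable def g₂Param (h : ℝ) (Λ₁ Λ₂ : Matrix (Fin n) (Fin n) ℝ) :
    Matrix (Fin n) (Fin n) ℝ :=
  (Λ₁ + Λ₂) * p.B *
      (p.invGap h Λ₁ Λ₂ + (p.R1 Λ₁)⁻¹ - (p.R2 Λ₁ Λ₂)⁻¹) * p.Bᵀ * (Λ₁ + Λ₂)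
  - (2 * h) • (Λ₂ * p.B * (p.R1 Λ₁)⁻¹ * p.Bᵀ * Λ₂)
  + (h - 2) • (Λ₂ * p.B * (h • p.invGap h Λ₁ Λ₂) * p.Bᵀ * Λ₂)
  - Λ₁ * p.B * (h • p.invGap h Λ₁ Λ₂) * p.Bᵀ * Λ₂
  - Λ₂ * p.B * (h • p.invGap h Λ₁ Λ₂) * p.Bᵀ * Λ₁
  + h • (Λ₂ * p.G + p.Gᵀ * Λ₂)

theorem EN_eq_smul_invGap (N : ℕ) (Λ₁ Λ₂ : Matrix (Fin n) (Fin n) ℝ) :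
    p.EN N Λ₁ Λ₂ = (1 / (N : ℝ)) • p.invGap (1 / (N : ℝ)) Λ₁ Λ₂ := rfl

theorem g₁_eq_g₁Param {N : ℕ} (hN : N ≠ 0) (Λ₁ Λ₂ : Matrix (Fin n) (Fin n) ℝ) :
    p.g₁ N Λ₁ Λ₂ = p.g₁Param (1 / (N : ℝ)) Λ₁ Λ₂ := by
  have hN' : (N : ℝ) ≠ 0 := Nat.cast_ne_zero.2 hN
  have hHN : p.HN N Λ₁ Λ₂ + ((N : ℝ) - 2) • p.EN N Λ₁ Λ₂ =
      (p.R1 Λ₁)⁻¹ + (1 - 1 / (N : ℝ)) • p.invGap (1 / (N : ℝ)) Λ₁ Λ₂ := by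
    rw [HN, EN_eq_smul_invGap]
    match_scalars <;> field_simp
    ring
  rw [g₁, hHN, g₁Param, EN_eq_smul_invGap, _root_.one_div_pow]

theorem g₂_eq_g₂Param {N : ℕ} (hN : N ≠ 0) (Λ₁ Λ₂ : Matrix (Fin n) (Fin n) ℝ) :
    p.g₂ N Λ₁ Λ₂ = p.g₂Param (1 / (N : ℝ)) Λ₁ Λ₂ := by
  have hN' : (N : ℝ) ≠ 0 := Nat.cast_ne_zero.2 hN
  have hEN : (N : ℝ) • p.EN N Λ₁ Λ₂ = p.invGap (1 / (N : ℝ)) Λ₁ Λ₂ := by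
    rw [EN_eq_smul_invGap, smul_smul, mul_one_div_cancel hN', one_smul]
  rw [g₂, hEN, g₂Param, EN_eq_smul_invGap, mul_one_div]

theorem g₁Param_zero (Λ₁ Λ₂ : Matrix (Fin n) (Fin n) ℝ) : p.g₁Param 0 Λ₁ Λ₂ = 0 := by
  simp [g₁Param]

theorem g₂Param_zero (Λ₁ Λ₂ : Matrix (Fin n) (Fin n) ℝ) : p.g₂Param 0 Λ₁ Λ₂ = 0 := by
  simp [g₂Param, invGap]

/-- The right-hand side of the rescaled system, parametrized by `h = 1 / N`. -/
noncomputable def rescaledField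
    (z : ℝ × Matrix (Fin n) (Fin n) ℝ × Matrix (Fin n) (Fin n) ℝ) :
    Matrix (Fin n) (Fin n) ℝ × Matrix (Fin n) (Fin n) ℝ :=
  (p.Ψ₁ z.2.1 + p.g₁Param z.1 z.2.1 z.2.2, p.Ψ₂ z.2.1 z.2.2 + p.g₂Param z.1 z.2.1 z.2.2)

/-- The field for `Λ̌₁`, in terms of `l = Λ̌₁` and `w = h Λ̌₂`. -/
noncomputable def checkField₁ (h : ℝ) (Θ : Matrix (Fin n₁) (Fin n) ℝ)
    (l w : Matrix (Fin n) (Fin n) ℝ) : Matrix (Fin n) (Fin n) ℝ :=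
  -(Θᵀ * p.R1 l * Θ + l * (p.A - p.B * Θ) + (p.A - p.B * Θ)ᵀ * l + p.Q
    + (Θᵀ * p.B0ᵀ * (h • l + (1 - h) • w) * p.B0 * Θ
      + (h • l + (1 - h) • w) * p.G + p.Gᵀ * (h • l + (1 - h) • w) + h • p.QΓ))

/-- The field for `w = h Λ̌₂`. -/
noncomputable def checkField₂ (h : ℝ) (Θ : Matrix (Fin n₁) (Fin n) ℝ)
    (l w : Matrix (Fin n) (Fin n) ℝ) : Matrix (Fin n) (Fin n) ℝ :=
  -(Θᵀ * p.B0ᵀ * (h • l + w) * p.B0 * Θ + h • (l * p.G + p.Gᵀ * l)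
    + w * (p.A + p.G - p.B * Θ) + (p.A + p.G - p.B * Θ)ᵀ * w + h • p.QΓ
    - h • (Θᵀ * p.B0ᵀ * w * p.B0 * Θ + w * p.G + p.Gᵀ * w))

/-- The field for the skew part `d = Λ̌₂ - Λ̌₂ᵀ`. -/
noncomputable def checkFieldSkew (h : ℝ) (Θ : Matrix (Fin n₁) (Fin n) ℝ)
    (l d : Matrix (Fin n) (Fin n) ℝ) : Matrix (Fin n) (Fin n) ℝ :=
  -(Θᵀ * p.B0ᵀ * ((l - lᵀ) + d) * p.B0 * Θ + (l - lᵀ) * p.G + p.Gᵀ * (l - lᵀ)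
    + d * (p.A + p.G - p.B * Θ) + (p.A + p.G - p.B * Θ)ᵀ * d
    - h • (Θᵀ * p.B0ᵀ * d * p.B0 * Θ + d * p.G + p.Gᵀ * d))

/-- The field for `x = Λ̌₁ + Λ̌₂ + Λ̌₁₂ + Λ̌₁₂ᵀ + Λ̌₂₂`. -/
noncomputable def checkFieldSum (h : ℝ) (Θ Θ₁ : Matrix (Fin n₁) (Fin n) ℝ)
    (l w d x : Matrix (Fin n) (Fin n) ℝ) : Matrix (Fin n) (Fin n) ℝ :=
  -((Θ + Θ₁)ᵀ * (p.R + p.B1ᵀ * l * p.B1 + p.B0ᵀ * x * p.B0) * (Θ + Θ₁)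
    + x * (p.A + p.G - p.B * (Θ + Θ₁)) + (p.A + p.G - p.B * (Θ + Θ₁))ᵀ * x
    + p.Q + p.QΓ
    - Θ₁ᵀ * (p.B1ᵀ * (l - lᵀ) * p.B1 + p.B0ᵀ * ((l - lᵀ) + d) * p.B0) * Θ
    + Θ₁ᵀ * p.Bᵀ * ((l - lᵀ) + d)
    + (Θᵀ * p.B0ᵀ * (h • l + (1 - h) • w) * p.B0 * Θ
      + (h • l + (1 - h) • w) * p.G + p.Gᵀ * (h • l + (1 - h) • w) + h • p.QΓ)
    - (Θᵀ * p.B0ᵀ * w * p.B0 * Θ + w * p.G + p.Gᵀ * w)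
    + (w * p.B * Θ₁ - Θᵀ * p.B0ᵀ * w * p.B0 * Θ₁)
    + (w * p.B * Θ₁ - Θᵀ * p.B0ᵀ * w * p.B0 * Θ₁)ᵀ
    - Θ₁ᵀ * p.B0ᵀ * w * p.B0 * Θ₁)

theorem neg_check1RHS (N : ℕ) (Θ : Matrix (Fin n₁) (Fin n) ℝ)
    (L1 L2 : Matrix (Fin n) (Fin n) ℝ) :
    -(p.check1RHS N Θ L1 L2) =
      p.checkField₁ (1 / (N : ℝ)) Θ L1 ((1 / (N : ℝ)) • L2) := by
  rw [check1RHS, gc1, checkField₁]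
  generalize 1 / (N : ℝ) = h
  simp only [Matrix.mul_add, Matrix.add_mul, Matrix.mul_smul, Matrix.smul_mul]
  module

theorem smul_neg_check2RHS (N : ℕ) (Θ : Matrix (Fin n₁) (Fin n) ℝ)
    (L1 L2 : Matrix (Fin n) (Fin n) ℝ) :
    (1 / (N : ℝ)) • -(p.check2RHS N Θ L1 L2) =
      p.checkField₂ (1 / (N : ℝ)) Θ L1 ((1 / (N : ℝ)) • L2) := by
  rw [check2RHS, gc2, checkField₂]
  generalize 1 / (N : ℝ) = h
  simp only [Matrix.mul_add, Matrix.add_mul, Matrix.mul_smul, Matrix.smul_mul]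
  module

theorem neg_check2RHS_sub_transpose (hQΓ : p.QΓᵀ = p.QΓ) (N : ℕ)
    (Θ : Matrix (Fin n₁) (Fin n) ℝ) (L1 L2 : Matrix (Fin n) (Fin n) ℝ) :
    -(p.check2RHS N Θ L1 L2) - (-(p.check2RHS N Θ L1 L2))ᵀ =
      p.checkFieldSkew (1 / (N : ℝ)) Θ L1 (L2 - L2ᵀ) := by
  rw [check2RHS, gc2, checkFieldSkew]
  generalize 1 / (N : ℝ) = h
  simp only [Matrix.mul_add, Matrix.add_mul, Matrix.mul_sub, Matrix.sub_mul,
    transpose_add, transpose_sub, transpose_neg, transpose_smul, transpose_mul,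
    transpose_transpose, hQΓ, Matrix.mul_assoc]
  module

theorem neg_check_sum (hR : p.Rᵀ = p.R) (N : ℕ)
    (Θ Θ₁ : Matrix (Fin n₁) (Fin n) ℝ) (L1 L2 L12 L22 : Matrix (Fin n) (Fin n) ℝ) :
    -(p.check1RHS N Θ L1 L2) + -(p.check2RHS N Θ L1 L2)
        + -(p.check12RHS N Θ Θ₁ L1 L2 L12) + (-(p.check12RHS N Θ Θ₁ L1 L2 L12))ᵀ
        + -(p.check22RHS N Θ₁ (-(p.B0 * (Θ + Θ₁))) (p.A + p.G - p.B * (Θ + Θ₁))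
            L1 L2 L12 L22) =
      p.checkFieldSum (1 / (N : ℝ)) Θ Θ₁ L1 ((1 / (N : ℝ)) • L2) (L2 - L2ᵀ)
        (L1 + L2 + L12 + L12ᵀ + L22) := by
  rw [check1RHS, check2RHS, check12RHS, check22RHS, gc1, gc2, gc12, gc22, checkFieldSum, R1, R2]
  generalize 1 / (N : ℝ) = h
  simp only [Matrix.mul_add, Matrix.add_mul, Matrix.mul_sub, Matrix.sub_mul,
    Matrix.mul_neg, Matrix.neg_mul, Matrix.mul_smul, Matrix.smul_mul,
    transpose_add, transpose_sub, transpose_neg, transpose_smul, transpose_mul,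
    transpose_transpose, hR, Matrix.mul_assoc]
  module

theorem transpose_R1 (hR : p.Rᵀ = p.R) {Λ₁ : Matrix (Fin n) (Fin n) ℝ} (h₁ : Λ₁ᵀ = Λ₁) :
    (p.R1 Λ₁)ᵀ = p.R1 Λ₁ := by
  simp [R1, hR, h₁, Matrix.mul_assoc]

theorem transpose_R2 (hR : p.Rᵀ = p.R) {Λ₁ Λ₂ : Matrix (Fin n) (Fin n) ℝ} (h₁ : Λ₁ᵀ = Λ₁)
    (h₂ : Λ₂ᵀ = Λ₂) : (p.R2 Λ₁ Λ₂)ᵀ = p.R2 Λ₁ Λ₂ := by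
  simp [R2, hR, h₁, h₂, Matrix.mul_assoc]

theorem Theta_add_Theta1 (Λ₁ Λ₂ : Matrix (Fin n) (Fin n) ℝ) :
    p.Theta Λ₁ + p.Theta1 Λ₁ Λ₂ = (p.R2 Λ₁ Λ₂)⁻¹ * p.Bᵀ * (Λ₁ + Λ₂) := by
  simp only [Theta, Theta1, Matrix.mul_add, Matrix.sub_mul]
  abel

theorem checkField₁_limit (hR : p.Rᵀ = p.R) {Λ₁ : Matrix (Fin n) (Fin n) ℝ} (h₁ : Λ₁ᵀ = Λ₁)
    (hdet : IsUnit (p.R1 Λ₁).det) :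
    p.checkField₁ 0 (p.Theta Λ₁) Λ₁ 0 = p.Ψ₁ Λ₁ := by
  have ht : ((p.R1 Λ₁)⁻¹)ᵀ = (p.R1 Λ₁)⁻¹ := by
    rw [transpose_nonsing_inv, p.transpose_R1 hR h₁]
  have hq : (p.Theta Λ₁)ᵀ * p.R1 Λ₁ * p.Theta Λ₁ = Λ₁ * p.B * p.Theta Λ₁ := by
    rw [Theta, transpose_mul, transpose_mul, ht, h₁, transpose_transpose]
    simp only [Matrix.mul_assoc]
    rw [nonsing_inv_mul_cancel_left _ _ hdet]
  have ht' : (p.Theta Λ₁)ᵀ * p.Bᵀ * Λ₁ = Λ₁ * p.B * p.Theta Λ₁ := by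
    rw [Theta, transpose_mul, transpose_mul, ht, h₁, transpose_transpose]
    simp only [Matrix.mul_assoc]
  rw [checkField₁, hq, Ψ₁]
  simp only [Matrix.mul_sub, Matrix.sub_mul, transpose_sub, transpose_mul, zero_smul, smul_zero,
    Matrix.mul_zero, Matrix.zero_mul, add_zero, ← Matrix.mul_assoc] at ht' ⊢
  rw [ht', Theta]
  simp only [← Matrix.mul_assoc]
  abel

theorem checkFieldSum_limit (hR : p.Rᵀ = p.R) {Λ₁ Λ₂ : Matrix (Fin n) (Fin n) ℝ} (h₁ : Λ₁ᵀ = Λ₁)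
    (h₂ : Λ₂ᵀ = Λ₂) (hdet : IsUnit (p.R2 Λ₁ Λ₂).det) :
    p.checkFieldSum 0 (p.Theta Λ₁) (p.Theta1 Λ₁ Λ₂) Λ₁ 0 0 (Λ₁ + Λ₂) = p.Ψ₁ Λ₁ + p.Ψ₂ Λ₁ Λ₂ := by
  have ht : ((p.R2 Λ₁ Λ₂)⁻¹)ᵀ = (p.R2 Λ₁ Λ₂)⁻¹ := by
    rw [transpose_nonsing_inv, p.transpose_R2 hR h₁ h₂]
  have h₁₂ : (Λ₁ + Λ₂)ᵀ = Λ₁ + Λ₂ := by rw [transpose_add, h₁, h₂]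
  rw [checkFieldSum, Theta_add_Theta1, Ψ₁, Ψ₂,
    show p.R + p.B1ᵀ * Λ₁ * p.B1 + p.B0ᵀ * (Λ₁ + Λ₂) * p.B0 = p.R2 Λ₁ Λ₂ from rfl]
  set K := (p.R2 Λ₁ Λ₂)⁻¹ * p.Bᵀ * (Λ₁ + Λ₂) with hK
  have hKt : Kᵀ = (Λ₁ + Λ₂) * p.B * (p.R2 Λ₁ Λ₂)⁻¹ := by
    rw [hK, transpose_mul, transpose_mul, ht, h₁₂, transpose_transpose, Matrix.mul_assoc]
  have hq : Kᵀ * p.R2 Λ₁ Λ₂ * K = (Λ₁ + Λ₂) * p.B * K := by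
    rw [hKt, nonsing_inv_mul_cancel_right _ _ hdet]
  have ht' : (p.B * K)ᵀ * (Λ₁ + Λ₂) = (Λ₁ + Λ₂) * p.B * K := by
    rw [transpose_mul, hKt, hK]
    simp only [Matrix.mul_assoc]
  have hm : (Λ₁ + Λ₂) * p.B * (p.R2 Λ₁ Λ₂)⁻¹ * p.Bᵀ * (Λ₁ + Λ₂) = (Λ₁ + Λ₂) * p.B * K := by
    rw [hK]; simp only [Matrix.mul_assoc]
  rw [hq, hm, transpose_sub, Matrix.sub_mul, ht', h₁]
  generalize Λ₁ * p.B * (p.R1 Λ₁)⁻¹ * p.Bᵀ * Λ₁ = Y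
  simp only [Matrix.mul_sub, ← Matrix.mul_assoc]
  generalize (Λ₁ + Λ₂) * p.B * K = X
  simp only [Matrix.mul_add, Matrix.add_mul, transpose_add, zero_smul, smul_zero, sub_self,
    Matrix.mul_zero, Matrix.zero_mul, add_zero, sub_zero, transpose_zero]
  abel

/-- The joint field for `(Λ₁, Λ₂, Λ̌₁, h Λ̌₂, Λ̌₂ - Λ̌₂ᵀ, Λ̌₁ + Λ̌₂ + Λ̌₁₂ + Λ̌₁₂ᵀ + Λ̌₂₂)`, with
parameter `h = 1 / N`. -/
noncomputable def checkField
    (z : ℝ × Matrix (Fin n) (Fin n) ℝ × Matrix (Fin n) (Fin n) ℝ × Matrix (Fin n) (Fin n) ℝ ×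
      Matrix (Fin n) (Fin n) ℝ × Matrix (Fin n) (Fin n) ℝ × Matrix (Fin n) (Fin n) ℝ) :
    Matrix (Fin n) (Fin n) ℝ × Matrix (Fin n) (Fin n) ℝ × Matrix (Fin n) (Fin n) ℝ ×
      Matrix (Fin n) (Fin n) ℝ × Matrix (Fin n) (Fin n) ℝ × Matrix (Fin n) (Fin n) ℝ :=
  (p.Ψ₁ z.2.1, p.Ψ₂ z.2.1 z.2.2.1,
    p.checkField₁ z.1 (p.Theta z.2.1) z.2.2.2.1 z.2.2.2.2.1,
    p.checkField₂ z.1 (p.Theta z.2.1) z.2.2.2.1 z.2.2.2.2.1,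
    p.checkFieldSkew z.1 (p.Theta z.2.1) z.2.2.2.1 z.2.2.2.2.2.1,
    p.checkFieldSum z.1 (p.Theta z.2.1) (p.Theta1 z.2.1 z.2.2.1) z.2.2.2.1 z.2.2.2.2.1
      z.2.2.2.2.2.1 z.2.2.2.2.2.2)

theorem contDiffAt_rescaledField {Λ₁ Λ₂ : Matrix (Fin n) (Fin n) ℝ}
    (h₁ : (p.R1 Λ₁).det ≠ 0) (h₂ : (p.R2 Λ₁ Λ₂).det ≠ 0) :
    ContDiffAt ℝ 1 p.rescaledField (0, Λ₁, Λ₂) := by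
  have h₂' : (p.R2 Λ₁ Λ₂ - (0 : ℝ) • (p.B0ᵀ * Λ₂ * p.B0)).det ≠ 0 := by simpa using h₂
  unfold R1 at h₁
  unfold R2 at h₂ h₂'
  unfold rescaledField Ψ₁ Ψ₂ g₁Param g₂Param invGap R1 R2
  fun_prop (disch := assumption)

theorem contDiffAt_checkField {Λ₁ Λ₂ : Matrix (Fin n) (Fin n) ℝ}
    (h₁ : (p.R1 Λ₁).det ≠ 0) (h₂ : (p.R2 Λ₁ Λ₂).det ≠ 0)
    (l w d x : Matrix (Fin n) (Fin n) ℝ) :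
    ContDiffAt ℝ 1 p.checkField (0, Λ₁, Λ₂, l, w, d, x) := by
  unfold R1 at h₁
  unfold R2 at h₂
  unfold checkField checkField₁ checkField₂ checkFieldSkew checkFieldSum Ψ₁ Ψ₂ Theta Theta1 R1 R2
  fun_prop (disch := assumption)

variable {p}

theorem IsSolLim.isUnit_det {Λ₁ Λ₂ : ℝ → Matrix (Fin n) (Fin n) ℝ} (hLim : p.IsSolLim Λ₁ Λ₂)
    {t : ℝ} (ht : t ∈ Icc (0 : ℝ) p.T) :
    IsUnit (p.R1 (Λ₁ t)).det ∧ IsUnit (p.R2 (Λ₁ t) (Λ₂ t)).det :=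
  ⟨((hLim.2.1 t ht).1.det_pos.ne').isUnit, ((hLim.2.1 t ht).2.det_pos.ne').isUnit⟩

theorem IsSolLim.hasDerivWithinAt {Λ₁ Λ₂ : ℝ → Matrix (Fin n) (Fin n) ℝ}
    (hLim : p.IsSolLim Λ₁ Λ₂) {t : ℝ} (ht : t ∈ Icc (0 : ℝ) p.T) :
    HasDerivWithinAt Λ₁ (p.Ψ₁ (Λ₁ t)) (Icc 0 p.T) t ∧
      HasDerivWithinAt Λ₂ (p.Ψ₂ (Λ₁ t) (Λ₂ t)) (Icc 0 p.T) t :=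
  ⟨hasDerivWithinAt_matrix.2 (hLim.2.2.2.2.1 t ht), hasDerivWithinAt_matrix.2 (hLim.2.2.2.2.2 t ht)⟩

/-- Solutions of the rescaled system are `O(1/N)`-close to the solution of the limiting system. -/
theorem IsSolLim.exists_rescaled_close {Λ₁ Λ₂ : ℝ → Matrix (Fin n) (Fin n) ℝ}
    (hLim : p.IsSolLim Λ₁ Λ₂) :
    ∃ h₀ : ℝ, 0 < h₀ ∧ ∃ C : ℝ, 0 < C ∧ ∀ N : ℕ, N ≠ 0 → 1 / (N : ℝ) ≤ h₀ →
      ∀ Λ₁N Λ₂N : ℝ → Matrix (Fin n) (Fin n) ℝ, p.IsSolLamN N Λ₁N Λ₂N →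
        ∀ t ∈ Icc (0 : ℝ) p.T,
          ‖Λ₁N t - Λ₁ t‖ ≤ C * (1 / (N : ℝ)) ∧ ‖Λ₂N t - Λ₂ t‖ ≤ C * (1 / (N : ℝ)) := by
  obtain ⟨h₀, hh₀, C, hC, H⟩ := exists_norm_sub_le_mul_of_contDiffAt (F := p.rescaledField)
    (T := p.T) (x := fun t => (Λ₁ t, Λ₂ t)) (p.QfΓ, 0)
    (fun t ht => by
      simpa [rescaledField, g₁Param_zero, g₂Param_zero] using
        (hLim.hasDerivWithinAt ht).1.prodMk (hLim.hasDerivWithinAt ht).2)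
    (fun t ht => p.contDiffAt_rescaledField (hLim.isUnit_det ht).1.ne_zero
      (hLim.isUnit_det ht).2.ne_zero)
  refine ⟨h₀, hh₀, C, hC, fun N hN hle Λ₁N Λ₂N hsol t ht => ?_⟩
  have hpos : 0 < 1 / (N : ℝ) := by positivity
  have key := H (1 / (N : ℝ)) hpos hle (fun t => (Λ₁N t, Λ₂N t))
    (by simp [hsol.2.2.1, hsol.2.2.2.1, hLim.2.2.1, hLim.2.2.2.1])
    (fun t ht => by
      rw [rescaledField, ← p.g₁_eq_g₁Param hN, ← p.g₂_eq_g₂Param hN]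
      exact (hasDerivWithinAt_matrix.2 (hsol.2.2.2.2.1 t ht)).prodMk
        (hasDerivWithinAt_matrix.2 (hsol.2.2.2.2.2 t ht))) t ht
  exact ⟨(norm_fst_le _).trans key, (norm_snd_le _).trans key⟩

theorem Standing.transpose_QΓ (hp : p.Standing) : p.QΓᵀ = p.QΓ := by
  have hQ : p.Qᵀ = p.Q := hp.2.2.2.1
  simp only [QΓ, transpose_sub, transpose_mul, transpose_transpose, hQ, Matrix.mul_assoc]
  abel

theorem Standing.transpose_QfΓ (hp : p.Standing) : p.QfΓᵀ = p.QfΓ := by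
  have hQ : p.Qfᵀ = p.Qf := hp.2.2.2.2.1
  simp only [QfΓ, transpose_sub, transpose_mul, transpose_transpose, hQ, Matrix.mul_assoc]
  abel

/-- The sum of the decentralized coefficients is `O(1/N)`-close to `Λ₁ + Λ₂`. -/
theorem IsSolLim.exists_check_close (hp : p.Standing) {Λ₁ Λ₂ : ℝ → Matrix (Fin n) (Fin n) ℝ}
    (hLim : p.IsSolLim Λ₁ Λ₂) :
    ∃ h₀ : ℝ, 0 < h₀ ∧ ∃ C : ℝ, 0 < C ∧ ∀ N : ℕ, N ≠ 0 → 1 / (N : ℝ) ≤ h₀ →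
      ∀ L1 L2 L12 L22 : ℝ → Matrix (Fin n) (Fin n) ℝ, p.IsSolCheckB N Λ₁ Λ₂ L1 L2 L12 L22 →
        ∀ t ∈ Icc (0 : ℝ) p.T,
          ‖L1 t + L2 t + L12 t + (L12 t)ᵀ + L22 t - (Λ₁ t + Λ₂ t)‖ ≤ C * (1 / (N : ℝ)) := by
  have hR : p.Rᵀ = p.R := hp.2.2.2.2.2
  obtain ⟨h₀, hh₀, C, hC, H⟩ := exists_norm_sub_le_mul_of_contDiffAt (F := p.checkField)
    (T := p.T) (x := fun t => (Λ₁ t, Λ₂ t, Λ₁ t, 0, 0, Λ₁ t + Λ₂ t))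
    (0, 0, p.QfΓ, p.QfΓ, 0, p.QfΓ)
    (fun t ht => by
      obtain ⟨h₁, h₂⟩ := hLim.hasDerivWithinAt ht
      obtain ⟨hs₁, hs₂⟩ := hLim.1 t ht
      have hw : p.checkField₂ 0 (p.Theta (Λ₁ t)) (Λ₁ t) 0 = 0 := by simp [checkField₂]
      have hd : p.checkFieldSkew 0 (p.Theta (Λ₁ t)) (Λ₁ t) 0 = 0 := by
        simp [checkFieldSkew, hs₁.eq]
      simp only [checkField, hw, hd, p.checkField₁_limit hR hs₁ (hLim.isUnit_det ht).1,
        p.checkFieldSum_limit hR hs₁ hs₂ (hLim.isUnit_det ht).2]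
      exact h₁.prodMk (h₂.prodMk (h₁.prodMk ((hasDerivWithinAt_const _ _ _).prodMk
        ((hasDerivWithinAt_const _ _ _).prodMk (h₁.add h₂))))))
    (fun t ht => p.contDiffAt_checkField (hLim.isUnit_det ht).1.ne_zero
      (hLim.isUnit_det ht).2.ne_zero _ _ _ _)
  refine ⟨h₀, hh₀, C, hC, fun N hN hle L1 L2 L12 L22 hsol t ht => ?_⟩
  obtain ⟨⟨hT1, hT2, hL1, hL2⟩, hT12, hT22, hL12, hL22⟩ := hsol
  have hpos : 0 < 1 / (N : ℝ) := by positivity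
  have key := H (1 / (N : ℝ)) hpos hle
    (fun t => (Λ₁ t, Λ₂ t, L1 t, (1 / (N : ℝ)) • L2 t, L2 t - (L2 t)ᵀ,
      L1 t + L2 t + L12 t + (L12 t)ᵀ + L22 t))
    (by
      simp only [hT1, hT2, hT12, hT22, hLim.2.2.1, hLim.2.2.2.1, hp.transpose_QfΓ, transpose_zero,
        sub_self, add_zero, zero_add, Prod.smul_mk, Prod.mk_add_mk, smul_zero, add_right_comm])
    (fun t ht => by
      obtain ⟨h₁, h₂⟩ := hLim.hasDerivWithinAt ht
      have d1 := hasDerivWithinAt_matrix.2 (hL1 t ht)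
      have d2 := hasDerivWithinAt_matrix.2 (hL2 t ht)
      have d12 := hasDerivWithinAt_matrix.2 (hL12 t ht)
      have d22 := hasDerivWithinAt_matrix.2 (hL22 t ht)
      rw [Z0, Z1] at d22
      rw [checkField, ← neg_check1RHS, ← smul_neg_check2RHS,
        ← p.neg_check2RHS_sub_transpose hp.transpose_QΓ, ← p.neg_check_sum hR]
      exact h₁.prodMk (h₂.prodMk (d1.prodMk ((d2.const_smul (1 / (N : ℝ))).prodMk
        ((d2.sub d2.matrix_transpose).prodMk
          ((((d1.add d2).add d12).add d12.matrix_transpose).add d22)))))) t ht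
  exact ((norm_snd_le _).trans <| (norm_snd_le _).trans <| (norm_snd_le _).trans <|
    (norm_snd_le _).trans <| norm_snd_le _).trans key

end Params

theorem frob_le_card_mul_norm {n : ℕ} (M : Matrix (Fin n) (Fin n) ℝ) : frob M ≤ n * ‖M‖ := by
  refine Real.sqrt_le_iff.2 ⟨by positivity, ?_⟩
  have h : ∀ i j, M i j ^ 2 ≤ ‖M‖ ^ 2 := fun i j =>
    sq_le_sq' (neg_le_of_abs_le (norm_entry_le_entrywise_sup_norm M))
      (le_of_abs_le (norm_entry_le_entrywise_sup_norm M))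
  calc ∑ i, ∑ j, M i j ^ 2 ≤ ∑ _i : Fin n, ∑ _j : Fin n, ‖M‖ ^ 2 := 
      Finset.sum_le_sum fun i _ => Finset.sum_le_sum fun j _ => h i j
    _ = (n * ‖M‖) ^ 2 := by simp; ring

/-- O(1/N) closeness of Λ₁^N + Λ₂^N to
Λ̌₁^N + Λ̌₂^N + Λ̌₁₂^N + (Λ̌₁₂^N)ᵀ + Λ̌₂₂^N. -/
theorem checkLam_sum_close {n n₁ : ℕ} (p : Params n n₁) (hp : p.Standing)
    (Λ₁ Λ₂ : ℝ → Matrix (Fin n) (Fin n) ℝ)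
    (S : ℝ → Matrix (Fin n) (Fin 1) ℝ) (r : ℝ → ℝ)
    (hLim : p.IsSolLim Λ₁ Λ₂) (hSr : p.IsSolSr Λ₁ Λ₂ S r) :
    ∃ N₁ : ℕ, 1 ≤ N₁ ∧ ∃ C : ℝ, 0 < C ∧
      ∀ N : ℕ, N₁ ≤ N →
        ∀ L1 L2 L12 L22 Λ₁N Λ₂N : ℝ → Matrix (Fin n) (Fin n) ℝ,
          p.IsSolCheckB N Λ₁ Λ₂ L1 L2 L12 L22 →
          p.IsSolLamN N Λ₁N Λ₂N →
          ∀ t ∈ Icc (0 : ℝ) p.T,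
            frob (Λ₁N t + Λ₂N t - (L1 t + L2 t + L12 t + (L12 t)ᵀ + L22 t))
              ≤ C / (N : ℝ) := by
  obtain ⟨h₁, hh₁, C₁, hC₁, H₁⟩ := hLim.exists_rescaled_close
  obtain ⟨h₂, hh₂, C₂, hC₂, H₂⟩ := hLim.exists_check_close hp
  obtain ⟨k, hk⟩ := exists_nat_one_div_lt (lt_min hh₁ hh₂)
  have hn : (0 : ℝ) < n := by exact_mod_cast hp.1
  refine ⟨k + 1, by omega, n * (2 * C₁ + C₂), by positivity, ?_⟩
  intro N hN L1 L2 L12 L22 Λ₁N Λ₂N hcheck hlam t ht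
  have hN0 : N ≠ 0 := by omega
  have hNh : 1 / (N : ℝ) ≤ min h₁ h₂ := by
    refine le_trans ?_ hk.le
    exact one_div_le_one_div_of_le (by positivity) (by exact_mod_cast hN)
  obtain ⟨ha, hb⟩ := H₁ N hN0 (hNh.trans (min_le_left _ _)) Λ₁N Λ₂N hlam t ht
  have hc := H₂ N hN0 (hNh.trans (min_le_right _ _)) L1 L2 L12 L22 hcheck t ht
  set X := L1 t + L2 t + L12 t + (L12 t)ᵀ + L22 t
  have hsplit : Λ₁N t + Λ₂N t - X =
      (Λ₁N t - Λ₁ t) + (Λ₂N t - Λ₂ t) - (X - (Λ₁ t + Λ₂ t)) := by abel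
  have hnorm : ‖Λ₁N t + Λ₂N t - X‖ ≤ (2 * C₁ + C₂) * (1 / (N : ℝ)) := by
    rw [hsplit]
    refine (norm_sub_le _ _).trans ?_
    linarith [norm_add_le (Λ₁N t - Λ₁ t) (Λ₂N t - Λ₂ t)]
  calc frob (Λ₁N t + Λ₂N t - X) ≤ n * ‖Λ₁N t + Λ₂N t - X‖ := frob_le_card_mul_norm _
    _ ≤ n * ((2 * C₁ + C₂) * (1 / (N : ℝ))) := by gcongr
    _ = n * (2 * C₁ + C₂) / (N : ℝ) := by ring

end LQ
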